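/- Let B and C be unital ℂ-algebras. Suppose z₁,…,z₄ and w₁,…,w₄ are elements of C with z_m w_l = η_{ml} w_l z_m for all m,l ∈ {1,…,4}, and suppose the family {z_m w_l : m,l ∈ {1,…,4}} is linearly independent over ℂ. Let A_{ij} ∈ B (i,j ∈ {1,…,4}) and define Z_i := Σ_m A_{im} ⊗ z_m and W_j := Σ_l A_{jl} ⊗ w_l in B ⊗_ℂ C. If Z_i W_j = η_{ij} W_j Z_i for all i,j ∈ {1,…,4}, then A_{im} A_{jl} = η_{ij} η_{lm} A_{jl} A_{im} for all i, j, l, m ∈ {1,…,4}. -/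

import Mathlib

open Matrix
open scoped TensorProduct

/-- The deformation parameter μ = exp(πiθ). -/
noncomputable def muDef (θ : ℝ) : ℂ := Complex.exp (Real.pi * Complex.I * θ)

/-- The 4×4 matrix of deformation parameters η. -/
noncomputable def etaDef (θ : ℝ) : Fin 4 → Fin 4 → ℂ :=
  ![![1, 1, starRingEnd ℂ (muDef θ), muDef θ],
    ![1, 1, muDef θ, starRingEnd ℂ (muDef θ)],
    ![muDef θ, starRingEnd ℂ (muDef θ), 1, 1],
    ![starRingEnd ℂ (muDef θ), muDef θ, 1, 1]]

theorem etaDef_mul_swap (θ : ℝ) (m l : Fin 4) : etaDef θ l m * etaDef θ m l = 1 := by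
  have hμ : muDef θ * starRingEnd ℂ (muDef θ) = 1 := by
    have hn : ‖muDef θ‖ = 1 := by
      simp [muDef, Complex.norm_exp]
    rw [Complex.mul_conj, Complex.normSq_eq_norm_sq, hn]
    norm_num
  have hμ_comm : starRingEnd ℂ (muDef θ) * muDef θ = 1 := by rw [mul_comm, hμ]
  fin_cases m <;> fin_cases l <;> simp [etaDef, hμ, hμ_comm]

/-- Coefficients of a linearly independent family in a tensor product over a field are unique. -/
theorem LinearIndependent.eq_of_sum_tmul_eq {K V W ι : Type*} [Field K] [AddCommGroup V]
    [Module K V] [AddCommGroup W] [Module K W] [Fintype ι] {c : ι → W}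
    (hc : LinearIndependent K c) {a b : ι → V}
    (h : ∑ i, a i ⊗ₜ[K] c i = ∑ i, b i ⊗ₜ[K] c i) : a = b := by
  classical
  obtain ⟨g, hg⟩ := (Finsupp.linearCombination K c).exists_leftInverse_of_injective
    (LinearMap.ker_eq_bot.2 hc)
  have hgc (i : ι) : g (c i) = Finsupp.single i 1 := by
    simpa using LinearMap.congr_fun hg (Finsupp.single i 1)
  funext i
  simpa [hgc, Finsupp.single_apply, ite_smul] using
    congrArg (TensorProduct.rid K V ∘ (Finsupp.lapply i ∘ₗ g).lTensor V) h

/-- If the coacted elements Z_i = Σ_m A_{im} ⊗ z_m and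
W_j = Σ_l A_{jl} ⊗ w_l satisfy Z_i W_j = η_{ij} W_j Z_i, then the quantum-group
generators satisfy A_{im} A_{jl} = η_{ij} η_{lm} A_{jl} A_{im}, provided the products
z_m w_l are linearly independent over ℂ. -/
theorem stmt15 (θ : ℝ) (B C : Type*) [Ring B] [Algebra ℂ B] [Ring C] [Algebra ℂ C]
    (z w : Fin 4 → C)
    (hzw : ∀ m l, z m * w l = etaDef θ m l • (w l * z m))
    (hli : LinearIndependent ℂ (fun p : Fin 4 × Fin 4 => z p.1 * w p.2))
    (A : Fin 4 → Fin 4 → B)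
    (h : ∀ i j, (∑ m, A i m ⊗ₜ[ℂ] z m : B ⊗[ℂ] C) * (∑ l, A j l ⊗ₜ[ℂ] w l) =
        etaDef θ i j • ((∑ l, A j l ⊗ₜ[ℂ] w l) * (∑ m, A i m ⊗ₜ[ℂ] z m))) :
    ∀ i j l m, A i m * A j l = (etaDef θ i j * etaDef θ l m) • (A j l * A i m) := by
  intro i j l m
  have hwz (m l : Fin 4) : w l * z m = etaDef θ l m • (z m * w l) := by
    rw [hzw, smul_smul, etaDef_mul_swap, one_smul]
  have key : ∑ p : Fin 4 × Fin 4, (A i p.1 * A j p.2) ⊗ₜ[ℂ] (z p.1 * w p.2) =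
      ∑ p : Fin 4 × Fin 4,
        ((etaDef θ i j * etaDef θ p.2 p.1) • (A j p.2 * A i p.1)) ⊗ₜ[ℂ] (z p.1 * w p.2) := by
    have hij := h i j
    simp only [Finset.sum_mul_sum, Algebra.TensorProduct.tmul_mul_tmul, hwz] at hij
    rw [Finset.sum_comm (f := fun l m => (A j l * A i m) ⊗ₜ[ℂ] (etaDef θ l m • (z m * w l)))]
      at hij
    simpa only [Fintype.sum_prod_type, Finset.smul_sum, TensorProduct.tmul_smul,
      ← TensorProduct.smul_tmul', smul_smul] using hij
  exact congrFun (hli.eq_of_sum_tmul_eq key) (m, l)
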